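/- arXiv:2402.16643 — 2 statements merged into one kernel-verified Lean document; each statement's English description precedes it below -/
import Mathlib

section
/- Let q = p^e be a prime power with p prime, k ≥ 2, and let M be a multiset of points in PG(k−1,q) whose support spans 𝔽_q^k and whose hyperplane multiplicities take exactly the two values s > t. Suppose M is non-repeated, i.e. gcd{M(P) : P point} = 1, and M does not have full support, i.e. M(Q) = 0 for some point Q. Then there exist integers u ≥ 1 and f ≥ 0 such that the two non-zero weights of the corresponding two-weight code satisfy #M − s = u·p^f and #M − t = (u+1)·p^f; in particular their difference s − t is a power of the characteristic p. -/
/-- The points of `PG(k-1,q)`: the 1-dimensional `F`-subspaces of `F^k`. -/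
abbrev ProjPoint (F : Type) [Field F] (k : ℕ) : Type :=
  {P : Submodule F (Fin k → F) // Module.finrank F P = 1}

/-- The hyperplanes of `PG(k-1,q)`: the `(k-1)`-dimensional `F`-subspaces of `F^k`. -/
abbrev ProjHyp (F : Type) [Field F] (k : ℕ) : Type :=
  {H : Submodule F (Fin k → F) // Module.finrank F H = k - 1}

/-- Additive extension of a function on points to subspaces:
`msum M S = Σ_{P point, P ⊆ S} M P`. -/
noncomputable def msum {F : Type} [Field F] {k : ℕ} {R : Type} [AddCommMonoid R]
    (M : ProjPoint F k → R) (S : Submodule F (Fin k → F)) : R :=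
  ∑ᶠ (P : ProjPoint F k) (_ : P.1 ≤ S), M P

/-- The Gaussian number `[m]_q = (q^m - 1)/(q - 1)`. -/
def gaussNum (q m : ℕ) : ℕ := (q ^ m - 1) / (q - 1)

open Finset Module in
/-- The number of non-zero linear functionals vanishing on `W`, plus one, is a power of `|F|`. -/
theorem card_nonzero_functionals_add_one {F : Type} [Field F] [Fintype F] {k : ℕ}
    [Fintype (Dual F (Fin k → F))] [DecidableEq (Dual F (Fin k → F))]
    (W : Submodule F (Fin k → F))
    [DecidablePred fun φ : Dual F (Fin k → F) => φ ∈ W.dualAnnihilator] :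
    #{φ : Dual F (Fin k → F) | φ ≠ 0 ∧ φ ∈ W.dualAnnihilator} + 1 =
      Fintype.card F ^ (k - finrank F W) := by
  have hdim := Subspace.finrank_add_finrank_dualAnnihilator_eq W
  rw [finrank_fin_fun] at hdim
  have hcard : #{φ : Dual F (Fin k → F) | φ ∈ W.dualAnnihilator} =
      Fintype.card F ^ (k - finrank F W) := by
    rw [← Fintype.card_subtype, show k - finrank F W = finrank F W.dualAnnihilator by omega]
    exact Module.card_eq_pow_finrank (K := F) (V := W.dualAnnihilator)
  rw [← hcard, filter_and, filter_ne', erase_inter, univ_inter]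
  exact card_erase_add_one (by simp)

open Finset Module in
/-- The number of hyperplanes containing `W` is the Gaussian number of its codimension. -/
theorem card_hyperplanes_ge {F : Type} [Field F] [Fintype F] {k : ℕ} (hk : 1 ≤ k)
    [Fintype (ProjHyp F k)] (W : Submodule F (Fin k → F))
    [DecidablePred fun H : ProjHyp F k => W ≤ H.1] :
    #{H : ProjHyp F k | W ≤ H.1} = gaussNum (Fintype.card F) (k - finrank F W) := by
  classical
  have : Finite (Dual F (Fin k → F)) := Module.finite_of_finite F
  have : Fintype (Dual F (Fin k → F)) := Fintype.ofFinite _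
  have hq : 1 < Fintype.card F := Fintype.one_lt_card
  have hker {φ : Dual F (Fin k → F)} (hφ : φ ≠ 0) :
      finrank F (LinearMap.ker φ) = k - 1 := by
    have := Dual.finrank_ker_add_one_of_ne_zero hφ
    rw [finrank_fin_fun] at this
    omega
  have key := card_mul_eq_card_mul
    (s := ({H : ProjHyp F k | W ≤ H.1} : Finset (ProjHyp F k)))
    (t := ({φ : Dual F (Fin k → F) | φ ≠ 0 ∧ φ ∈ W.dualAnnihilator} : Finset _))
    (fun H φ => H.1 = LinearMap.ker φ) (m := Fintype.card F - 1) (n := 1) ?_ ?_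
  · have hW := card_nonzero_functionals_add_one W
    rw [mul_one] at key
    rw [gaussNum, ← hW, Nat.add_sub_cancel, ← key, Nat.mul_div_cancel _ (by omega)]
  · intro H hH
    have hH' := card_nonzero_functionals_add_one H.1
    rw [H.2, show k - (k - 1) = 1 by omega, pow_one] at hH'
    rw [← hH', Nat.add_sub_cancel]
    congr 1
    ext φ
    simp only [mem_filter, mem_univ, true_and, bipartiteAbove] at hH ⊢
    constructor
    · rintro ⟨⟨h0, -⟩, h⟩
      refine ⟨h0, (Submodule.mem_dualAnnihilator φ).2 fun w hw => ?_⟩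
      rw [h] at hw
      exact hw
    · rintro ⟨h0, h⟩
      rw [Submodule.mem_dualAnnihilator] at h
      refine ⟨⟨h0, (Submodule.mem_dualAnnihilator φ).2 fun w hw => h w (hH hw)⟩, ?_⟩
      exact Submodule.eq_of_le_of_finrank_eq h (H.2.trans (hker h0).symm)
  · intro φ hφ
    simp only [mem_filter, mem_univ, true_and] at hφ
    rw [card_eq_one]
    refine ⟨⟨LinearMap.ker φ, hker hφ.1⟩, ?_⟩
    ext H
    simp only [bipartiteBelow, mem_filter, mem_univ, true_and, mem_singleton, Subtype.ext_iff]
    refine ⟨And.right, fun h => ⟨?_, h⟩⟩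
    rw [h]
    exact fun w hw => (Submodule.mem_dualAnnihilator φ).1 hφ.2 w hw

theorem gaussNum_mul_add_one {q : ℕ} (hq : 1 < q) (m : ℕ) :
    gaussNum q m * (q - 1) + 1 = q ^ m := by
  have : 1 ≤ q ^ m := Nat.one_le_pow _ _ (by omega)
  rw [gaussNum, Nat.div_mul_cancel (Nat.sub_one_dvd_pow_sub_one q m)]
  omega

theorem gaussNum_succ {q : ℕ} (hq : 1 < q) (m : ℕ) :
    gaussNum q (m + 1) = gaussNum q m + q ^ m := by
  have h1 := gaussNum_mul_add_one hq m
  have h2 := gaussNum_mul_add_one hq (m + 1)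
  obtain ⟨r, rfl⟩ := Nat.exists_eq_add_of_lt hq
  rw [show 1 + r + 1 - 1 = r + 1 by omega] at h1 h2
  refine Nat.eq_of_mul_eq_mul_right (Nat.succ_pos r) ?_
  rw [pow_succ] at h2
  simp only [Nat.succ_eq_add_one]
  linarith

open Finset in
theorem msum_eq_sum_ite {F : Type} [Field F] {k : ℕ} [Fintype (ProjPoint F k)]
    (M : ProjPoint F k → ℕ) (S : Submodule F (Fin k → F))
    [DecidablePred fun P : ProjPoint F k => P.1 ≤ S] :
    msum M S = ∑ P : ProjPoint F k, if P.1 ≤ S then M P else 0 := by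
  rw [msum, finsum_eq_sum_of_fintype]
  exact sum_congr rfl fun P _ => finsum_eq_if

open Module in
theorem finrank_sup_of_ne {F : Type} [Field F] {k : ℕ} {P P' : ProjPoint F k} (h : P ≠ P') :
    finrank F ↥(P.1 ⊔ P'.1) = 2 := by
  have hsum := Submodule.finrank_sup_add_finrank_inf_eq P.1 P'.1
  rw [P.2, P'.2] at hsum
  suffices finrank F ↥(P.1 ⊓ P'.1) = 0 by omega
  by_contra hne
  have hP : P.1 ⊓ P'.1 = P.1 :=
    Submodule.eq_of_le_of_finrank_le inf_le_left (by rw [P.2]; omega)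
  have hP' : P.1 ⊓ P'.1 = P'.1 :=
    Submodule.eq_of_le_of_finrank_le inf_le_right (by rw [P'.2]; omega)
  exact h (Subtype.ext (hP.symm.trans hP'))

open Finset Module in
/-- Summing the multiplicities of the hyperplanes through a point. -/
theorem sum_msum_hyperplanes_through {F : Type} [Field F] [Fintype F] {k : ℕ} (hk : 2 ≤ k)
    [Fintype (ProjHyp F k)] (M : ProjPoint F k → ℕ) (P : ProjPoint F k)
    [DecidablePred fun H : ProjHyp F k => P.1 ≤ H.1] :
    ∑ H : ProjHyp F k with P.1 ≤ H.1, msum M H.1 =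
      M P * Fintype.card F ^ (k - 2) + msum M ⊤ * gaussNum (Fintype.card F) (k - 2) := by
  classical
  have : Fintype (ProjPoint F k) := Fintype.ofFinite _
  have hcount (P' : ProjPoint F k) :
      (∑ H : ProjHyp F k with P.1 ≤ H.1, if P'.1 ≤ H.1 then M P' else 0) =
        (if P = P' then M P' * Fintype.card F ^ (k - 2) else 0) +
          M P' * gaussNum (Fintype.card F) (k - 2) := by
    rw [← sum_filter, filter_filter, sum_const, smul_eq_mul, mul_comm]
    simp_rw [← sup_le_iff]
    rw [card_hyperplanes_ge (by omega)]
    split_ifs with h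
    · subst h
      rw [sup_idem, P.2, show k - 1 = k - 2 + 1 by omega, gaussNum_succ Fintype.one_lt_card]
      ring
    · rw [finrank_sup_of_ne h, zero_add]
  simp_rw [msum_eq_sum_ite]
  rw [sum_comm, sum_congr rfl fun P' _ => hcount P', sum_add_distrib, sum_mul]
  simp

open Finset in
/-- In a two-character multiset, the multiplicity of a point is determined by the number of
hyperplanes of the larger multiplicity passing through it. -/
theorem exists_two_character_identity {F : Type} [Field F] [Fintype F] {k : ℕ} (hk : 2 ≤ k)
    (M : ProjPoint F k → ℕ) {t d : ℕ}
    (h2 : ∀ H : ProjHyp F k, msum M H.1 = t + d ∨ msum M H.1 = t) (P : ProjPoint F k) :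
    ∃ a : ℕ, t * (gaussNum (Fintype.card F) (k - 2) + Fintype.card F ^ (k - 2)) + d * a =
      M P * Fintype.card F ^ (k - 2) + msum M ⊤ * gaussNum (Fintype.card F) (k - 2) := by
  classical
  have : Fintype (ProjHyp F k) := Fintype.ofFinite _
  have hval (H : ProjHyp F k) : ∃ c, msum M H.1 = t + d * c :=
    (h2 H).elim (fun h => ⟨1, by rw [h, mul_one]⟩) fun h => ⟨0, by rw [h, mul_zero, add_zero]⟩
  choose c hc using hval
  refine ⟨∑ H : ProjHyp F k with P.1 ≤ H.1, c H, ?_⟩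
  rw [← sum_msum_hyperplanes_through hk, sum_congr rfl fun H _ => hc H, sum_add_distrib,
    sum_const, smul_eq_mul, card_hyperplanes_ge (by omega), P.2, mul_sum,
    ← gaussNum_succ Fintype.one_lt_card, show k - 2 + 1 = k - 1 by omega, mul_comm t]

open Finset in
/-- A hyperplane does not contain the whole of a spanning multiset. -/
theorem msum_hyperplane_lt {F : Type} [Field F] [Fintype F] {k : ℕ} (hk : 1 ≤ k)
    (M : ProjPoint F k → ℕ)
    (hspan : (⨆ (P : ProjPoint F k) (_ : 0 < M P), P.1) = (⊤ : Submodule F (Fin k → F)))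
    (H : ProjHyp F k) : msum M H.1 < msum M ⊤ := by
  classical
  have : Fintype (ProjPoint F k) := Fintype.ofFinite _
  obtain ⟨P, hP, hPH⟩ : ∃ P : ProjPoint F k, 0 < M P ∧ ¬ P.1 ≤ H.1 := by
    by_contra! hcon
    have htop : H.1 = ⊤ := top_le_iff.1 (hspan ▸ iSup₂_le hcon)
    have hH := H.2
    rw [htop, finrank_top, Module.finrank_fin_fun] at hH
    omega
  simp_rw [msum_eq_sum_ite]
  refine sum_lt_sum (fun P' _ => ?_) ⟨P, mem_univ P, ?_⟩
  · split_ifs <;> simp_all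
  · simpa [hPH] using hP

/-- a non-repetitive spanning two-character multiset without full support has
weights `#M − s = u·p^f` and `#M − t = (u+1)·p^f`; in particular `s − t` is a power of
the characteristic `p`. -/
theorem nonrepetitive_two_weight_weights
    (F : Type) [Field F] [Fintype F] (p e k : ℕ) (hp : p.Prime)
    (hq : Fintype.card F = p ^ e) (hk : 2 ≤ k)
    (M : ProjPoint F k → ℕ)
    (hspan : (⨆ (P : ProjPoint F k) (_ : 0 < M P), P.1) = (⊤ : Submodule F (Fin k → F)))
    (s t : ℕ) (hst : t < s)
    (h2 : ∀ H : ProjHyp F k, msum M H.1 = s ∨ msum M H.1 = t)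
    (hs : ∃ H : ProjHyp F k, msum M H.1 = s)
    (ht : ∃ H : ProjHyp F k, msum M H.1 = t)
    (hgcd : ∀ d : ℕ, (∀ P : ProjPoint F k, d ∣ M P) → d = 1)
    (hQ : ∃ Q : ProjPoint F k, M Q = 0) :
    ∃ u f : ℕ, 1 ≤ u ∧
      msum M (⊤ : Submodule F (Fin k → F)) = s + u * p ^ f ∧
      msum M (⊤ : Submodule F (Fin k → F)) = t + (u + 1) * p ^ f ∧
      s - t = p ^ f := by
  obtain ⟨d, rfl⟩ := Nat.exists_eq_add_of_le hst.le
  obtain ⟨Q, hQ⟩ := hQ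
  have key := exists_two_character_identity hk M h2
  have hB := gaussNum_mul_add_one (Fintype.one_lt_card (α := F)) (k - 2)
  have hq1 : 1 ≤ Fintype.card F := Fintype.card_pos
  set n := msum M ⊤
  set B := gaussNum (Fintype.card F) (k - 2)
  set q := Fintype.card F
  obtain ⟨a, ha⟩ := key Q
  rw [hQ, zero_mul, zero_add] at ha
  have hdM (P : ProjPoint F k) : d ∣ M P * q ^ (k - 2) := by
    obtain ⟨b, hb⟩ := key P
    have h : d * b = M P * q ^ (k - 2) + d * a := by omega
    exact (Nat.dvd_add_left (dvd_mul_right d a)).1 (h ▸ dvd_mul_right d b)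
  have hdq : d ∣ q ^ (k - 2) := by
    have hcop (P : ProjPoint F k) : d / d.gcd (q ^ (k - 2)) ∣ M P := by
      have hd0 : 0 < d.gcd (q ^ (k - 2)) := Nat.gcd_pos_of_pos_left _ (by omega)
      refine (Nat.coprime_div_gcd_div_gcd hd0).dvd_of_dvd_mul_right ?_
      rw [← Nat.mul_div_assoc _ (Nat.gcd_dvd_right _ _)]
      exact Nat.div_dvd_div (Nat.gcd_dvd_left _ _) (hdM P)
    have h1 := hgcd _ hcop
    have h2 := Nat.div_mul_cancel (Nat.gcd_dvd_left d (q ^ (k - 2)))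
    rw [h1, one_mul] at h2
    exact Nat.gcd_eq_left_iff_dvd.1 h2
  have hdp : d ∣ p ^ (e * (k - 2)) := by rwa [pow_mul, ← hq]
  obtain ⟨f, -, hf⟩ := (Nat.dvd_prime_pow hp).1 hdp
  obtain ⟨H, hH⟩ := hs
  have hlt : t + d < n := hH ▸ msum_hyperplane_lt (by omega) M hspan H
  obtain ⟨w, hw⟩ := Nat.exists_eq_add_of_lt hlt
  have hdw : d ∣ w + 1 := by
    obtain ⟨c, hc⟩ := hdq
    zify [hq1] at ha hB hc hw ⊢
    refine ⟨(w + d + 1) * c - (a + t * c) * (q - 1) - 1, ?_⟩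
    rw [hw] at ha
    rw [hc] at ha hB
    linear_combination ((w : ℤ) + d + 1) * hB + ((q : ℤ) - 1) * ha
  obtain ⟨u, hu⟩ := hdw
  refine ⟨u, f, ?_, ?_, ?_, ?_⟩
  · exact Nat.pos_of_ne_zero fun h => by simp [h] at hu
  · rw [← hf, mul_comm, ← hu, hw, add_assoc]
  · rw [← hf, add_mul, mul_comm u, ← hu, hw]
    ring
  · rw [← hf, Nat.add_sub_cancel_left]
end

section
/- Let q be a prime power, k ≥ 2, and let M be a canonical two-character multiset in PG(k−1,q), i.e., a multiset of points whose hyperplane multiplicities take exactly two distinct values, whose minimum point multiplicity is 0, and for which gcd{M(P) : P point} = 1. Then M(P) ≤ q^{k−2} for every point P. -/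
open scoped Classical in
theorem msum_eq_sum {F : Type} [Field F] [Fintype F] {k : ℕ} [Fintype (ProjPoint F k)]
    (M : ProjPoint F k → ℕ) (S : Submodule F (Fin k → F)) :
    msum M S = ∑ P : ProjPoint F k, if P.1 ≤ S then M P else 0 := by
  unfold msum
  rw [finsum_eq_sum_of_fintype]
  exact Finset.sum_congr rfl fun P _ => finsum_eq_if

open scoped Classical in
theorem sum_msum_ker {F : Type} [Field F] [Fintype F] {k : ℕ} [Fintype (ProjPoint F k)]
    (M : ProjPoint F k → ℕ) (A : Finset (Module.Dual F (Fin k → F))) :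
    ∑ f ∈ A, msum M (LinearMap.ker f) =
      ∑ P : ProjPoint F k, (A.filter fun f => P.1 ≤ LinearMap.ker f).card * M P := by
  simp_rw [msum_eq_sum]
  rw [Finset.sum_comm]
  refine Finset.sum_congr rfl fun P _ => ?_
  rw [← Finset.sum_filter, Finset.sum_const, smul_eq_mul]

theorem ProjPoint.exists_eq_span {F : Type} [Field F] {k : ℕ} (P : ProjPoint F k) :
    ∃ v : Fin k → F, v ≠ 0 ∧ P.1 = Submodule.span F {v} := by
  obtain ⟨v, hv, h⟩ := finrank_eq_one_iff'.1 P.2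
  refine ⟨v, fun h0 => hv (Subtype.ext h0), le_antisymm ?_ ?_⟩
  · intro w hw
    obtain ⟨c, hc⟩ := h ⟨w, hw⟩
    exact Submodule.mem_span_singleton.2 ⟨c, congrArg Subtype.val hc⟩
  · exact (Submodule.span_singleton_le_iff_mem _ _).2 v.2

theorem exists_dual_eq_one_of_notMem {F V : Type*} [Field F] [AddCommGroup V] [Module F V]
    {S : Submodule F V} {x : V} (hx : x ∉ S) :
    ∃ f : Module.Dual F V, f x = 1 ∧ ∀ y ∈ S, f y = 0 := by
  obtain ⟨f, hf, hS⟩ := Submodule.exists_le_ker_of_notMem hx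
  refine ⟨(f x)⁻¹ • f, by simp [hf], fun y hy => ?_⟩
  have : f y = 0 := hS hy
  simp [this]

open scoped Classical in
/-- The functionals vanishing at `p` and taking the value `1` at `r`. They represent, each exactly
once, the hyperplanes through `p` that avoid `r`. -/
noncomputable def dualsZeroOne {F V : Type*} [Field F] [AddCommGroup V] [Module F V]
    [Fintype (Module.Dual F V)] (p r : V) : Finset (Module.Dual F V) :=
  Finset.univ.filter fun f => f p = 0 ∧ f r = 1

section

variable {F V : Type*} [Field F] [AddCommGroup V] [Module F V] [Fintype (Module.Dual F V)]

theorem mem_dualsZeroOne {p r : V} {f : Module.Dual F V} :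
    f ∈ dualsZeroOne p r ↔ f p = 0 ∧ f r = 1 := by
  simp [dualsZeroOne]

theorem card_dualsZeroOne [Fintype F] [FiniteDimensional F V] {p r : V} {fp fr : Module.Dual F V}
    (hpp : fp p = 1) (hpr : fp r = 0) (hrp : fr p = 0) (hrr : fr r = 1) :
    (dualsZeroOne (F := F) p r).card = Fintype.card F ^ (Module.finrank F V - 2) := by
  let φ : Module.Dual F V →ₗ[F] F × F :=
    (Module.Dual.eval F V p).prod (Module.Dual.eval F V r)
  have hφ : ∀ f, φ f = (f p, f r) := fun f => rfl
  have hsurj : LinearMap.range φ = ⊤ := by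
    rw [LinearMap.range_eq_top]
    rintro ⟨a, b⟩
    exact ⟨a • fp + b • fr, by simp [hφ, hpp, hpr, hrp, hrr]⟩
  have hrank := φ.finrank_range_add_finrank_ker
  rw [hsurj, finrank_top, Module.finrank_prod, Module.finrank_self, Subspace.dual_finrank_eq]
    at hrank
  have hker : Module.finrank F (LinearMap.ker φ) = Module.finrank F V - 2 := by omega
  have := Fintype.ofFinite (LinearMap.ker φ)
  rw [← hker, ← Module.card_eq_pow_finrank (K := F) (V := LinearMap.ker φ), ← Finset.card_univ]
  refine Finset.card_bij' (fun f hf => ⟨f - fr, ?_⟩) (fun f _ => f.1 + fr) ?_ ?_ ?_ ?_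
  · simp [hφ, mem_dualsZeroOne.1 hf, hrp, hrr]
  · simp
  · rintro ⟨f, hf⟩ -
    have hf' : f p = 0 ∧ f r = 0 := by simpa [hφ] using hf
    simp [mem_dualsZeroOne, hf', hrp, hrr]
  · simp
  · simp

open scoped Classical in
theorem card_filter_dualsZeroOne_comm {p r x : V} {fp fr h : Module.Dual F V}
    (hpp : fp p = 1) (hpr : fp r = 0) (hrp : fr p = 0) (hrr : fr r = 1)
    (hp : h p = 0) (hr : h r = 0) (hx : h x = 1) :
    ((dualsZeroOne (F := F) p r).filter fun f => f x = 0).card =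
      ((dualsZeroOne (F := F) r p).filter fun f => f x = 0).card := by
  let g : Module.Dual F V := fp - fr - (fp x - fr x) • h
  refine Finset.card_bij' (fun f _ => f + g) (fun f _ => f - g) ?_ ?_ ?_ ?_
  · simp +contextual [mem_dualsZeroOne, g, hpp, hpr, hrp, hrr, hp, hr, hx]
  · simp +contextual [mem_dualsZeroOne, g, hpp, hpr, hrp, hrr, hp, hr, hx]
  · simp
  · simp

end

/-- If `R` has multiplicity `0`, then the multiplicity of `P` is obtained by comparing the
hyperplanes through `P` that avoid `R` with those through `R` that avoid `P`. -/
theorem sum_msum_ker_dualsZeroOne {F : Type} [Field F] [Fintype F] {k : ℕ}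
    [Fintype (Module.Dual F (Fin k → F))] (M : ProjPoint F k → ℕ) {P R : ProjPoint F k}
    (hR : M R = 0) {p r : Fin k → F} (hp : P.1 = Submodule.span F {p})
    (hr : R.1 = Submodule.span F {r}) {fp fr : Module.Dual F (Fin k → F)}
    (hpp : fp p = 1) (hpr : fp r = 0) (hrp : fr p = 0) (hrr : fr r = 1) :
    ∑ f ∈ dualsZeroOne p r, msum M (LinearMap.ker f) =
      ∑ f ∈ dualsZeroOne r p, msum M (LinearMap.ker f) +
        (dualsZeroOne (F := F) p r).card * M P := by
  classical
  have := Fintype.ofFinite (ProjPoint F k)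
  rw [sum_msum_ker, sum_msum_ker,
    ← Finset.add_sum_erase _ _ (Finset.mem_univ P),
    ← Finset.add_sum_erase (a := P) _
      (fun Q => ((dualsZeroOne r p).filter fun f => Q.1 ≤ LinearMap.ker f).card * M Q)
      (Finset.mem_univ P)]
  have h1 : (dualsZeroOne p r).filter (fun f => P.1 ≤ LinearMap.ker f) = dualsZeroOne p r := by
    refine Finset.filter_true_of_mem fun f hf => ?_
    simpa [hp, Submodule.span_singleton_le_iff_mem] using (mem_dualsZeroOne.1 hf).1
  have h2 : (dualsZeroOne r p).filter (fun f => P.1 ≤ LinearMap.ker f) = ∅ := by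
    refine Finset.filter_false_of_mem fun f hf => ?_
    simp [hp, Submodule.span_singleton_le_iff_mem, (mem_dualsZeroOne.1 hf).2]
  rw [h1, h2, Finset.card_empty, zero_mul, zero_add, add_comm]
  congr 1
  refine Finset.sum_congr rfl fun Q hQ => ?_
  by_cases hQR : Q = R
  · simp [hQR, hR]
  obtain ⟨x, hx0, hx⟩ := Q.exists_eq_span
  simp only [hx, Submodule.span_singleton_le_iff_mem, LinearMap.mem_ker]
  congr 1
  by_cases hmem : x ∈ Submodule.span F {p, r}
  · obtain ⟨a, b, rfl⟩ := Submodule.mem_span_pair.1 hmem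
    have hb : b ≠ 0 := by
      rintro rfl
      have ha : a ≠ 0 := by rintro rfl; simp at hx0
      refine (Finset.ne_of_mem_erase hQ) (Subtype.ext ?_)
      rw [hx, hp, zero_smul, add_zero, Submodule.span_singleton_smul_eq ha.isUnit]
    have ha : a ≠ 0 := by
      rintro rfl
      refine hQR (Subtype.ext ?_)
      rw [hx, hr, zero_smul, zero_add, Submodule.span_singleton_smul_eq hb.isUnit]
    rw [Finset.filter_false_of_mem, Finset.filter_false_of_mem]
    · intro f hf
      simp [mem_dualsZeroOne.1 hf, ha]
    · intro f hf
      simp [mem_dualsZeroOne.1 hf, hb]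
  · obtain ⟨h, h1, h0⟩ := exists_dual_eq_one_of_notMem hmem
    exact card_filter_dualsZeroOne_comm hpp hpr hrp hrr
      (h0 p (Submodule.subset_span (by simp))) (h0 r (Submodule.subset_span (by simp))) h1

theorem exists_sum_eq_of_two_valued {ι : Type*} (A : Finset ι) (g : ι → ℕ) (s t : ℕ)
    (h : ∀ i ∈ A, g i = s ∨ g i = t) :
    ∃ c ≤ A.card, (∑ i ∈ A, (g i : ℤ)) = A.card * s + ((t : ℤ) - s) * c := by
  refine ⟨(A.filter fun i => g i = t).card, Finset.card_filter_le _ _, ?_⟩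
  rw [Finset.card_filter, Nat.cast_sum, Finset.mul_sum, ← nsmul_eq_mul, ← Finset.sum_const,
    ← Finset.sum_add_distrib]
  refine Finset.sum_congr rfl fun i hi => ?_
  rcases h i hi with h | h <;> by_cases hst : s = t <;> simp [h, hst]

/-- Each point multiplicity, scaled by `q ^ (k - 2)`, is a multiple of the difference of the two
hyperplane multiplicities, with a factor bounded by `q ^ (k - 2)`. -/
theorem exists_mul_eq_sub_mul {F : Type} [Field F] [Fintype F] {k : ℕ}
    {M : ProjPoint F k → ℕ} {s t : ℕ}
    (h2 : ∀ H : ProjHyp F k, msum M H.1 = s ∨ msum M H.1 = t)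
    {R : ProjPoint F k} (hR : M R = 0) (P : ProjPoint F k) :
    ∃ c : ℤ, |c| ≤ (Fintype.card F ^ (k - 2) : ℕ) ∧
      ((Fintype.card F ^ (k - 2) : ℕ) : ℤ) * M P = ((t : ℤ) - s) * c := by
  classical
  by_cases hPR : P = R
  · exact ⟨0, by simp, by simp [hPR, hR]⟩
  have : Finite (Module.Dual F (Fin k → F)) := Module.finite_of_finite F
  have := Fintype.ofFinite (Module.Dual F (Fin k → F))
  obtain ⟨p, hp0, hp⟩ := P.exists_eq_span
  obtain ⟨r, hr0, hr⟩ := R.exists_eq_span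
  have hpr : p ∉ Submodule.span F {r} := by
    intro h
    obtain ⟨c, rfl⟩ := Submodule.mem_span_singleton.1 h
    have hc : c ≠ 0 := by rintro rfl; simp at hp0
    exact hPR (Subtype.ext (by rw [hp, hr, Submodule.span_singleton_smul_eq hc.isUnit]))
  have hrp : r ∉ Submodule.span F {p} := by
    intro h
    obtain ⟨c, rfl⟩ := Submodule.mem_span_singleton.1 h
    have hc : c ≠ 0 := by rintro rfl; simp at hr0
    exact hPR (Subtype.ext (by rw [hp, hr, Submodule.span_singleton_smul_eq hc.isUnit]))
  obtain ⟨fp, hfpp, hfpr⟩ := exists_dual_eq_one_of_notMem hpr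
  obtain ⟨fr, hfrr, hfrp⟩ := exists_dual_eq_one_of_notMem hrp
  replace hfpr := hfpr r (Submodule.mem_span_singleton_self r)
  replace hfrp := hfrp p (Submodule.mem_span_singleton_self p)
  have hA := card_dualsZeroOne hfpp hfpr hfrp hfrr
  have hB := card_dualsZeroOne hfrr hfrp hfpr hfpp
  have key := sum_msum_ker_dualsZeroOne M hR hp hr hfpp hfpr hfrp hfrr
  have htwo : ∀ x y : Fin k → F, ∀ f ∈ dualsZeroOne (F := F) x y,
      msum M (LinearMap.ker f) = s ∨ msum M (LinearMap.ker f) = t := by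
    intro x y f hf
    have hf0 : f ≠ 0 := by
      rintro rfl
      simpa using (mem_dualsZeroOne.1 hf).2
    have hrank := Module.Dual.finrank_ker_add_one_of_ne_zero hf0
    rw [Module.finrank_fin_fun] at hrank
    exact h2 ⟨LinearMap.ker f, by omega⟩
  have keyZ := congrArg (Nat.cast (R := ℤ)) key
  push_cast at keyZ
  obtain ⟨a, ha, hsumA⟩ := exists_sum_eq_of_two_valued _ _ s t (htwo p r)
  obtain ⟨b, hb, hsumB⟩ := exists_sum_eq_of_two_valued _ _ s t (htwo r p)
  rw [hsumA, hsumB, hA, hB, Module.finrank_fin_fun] at keyZ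
  rw [hA, Module.finrank_fin_fun] at ha
  rw [hB, Module.finrank_fin_fun] at hb
  refine ⟨a - b, abs_le.2 ⟨by omega, by omega⟩, by linarith⟩

/-- a canonical two-character multiset (two distinct hyperplane
multiplicities, both attained; minimum point multiplicity `0`; gcd of all point
multiplicities equal to `1`) has all point multiplicities at most `q^{k-2}`. -/
theorem canonical_max_point_multiplicity
    (F : Type) [Field F] [Fintype F] (k : ℕ) (hk : 2 ≤ k)
    (M : ProjPoint F k → ℕ) (s t : ℕ) (hst : s ≠ t)
    (h2 : ∀ H : ProjHyp F k, msum M H.1 = s ∨ msum M H.1 = t)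
    (hs : ∃ H : ProjHyp F k, msum M H.1 = s)
    (ht : ∃ H : ProjHyp F k, msum M H.1 = t)
    (hmin : ∃ P : ProjPoint F k, M P = 0)
    (hgcd : ∀ d : ℕ, (∀ P : ProjPoint F k, d ∣ M P) → d = 1) :
    ∀ P : ProjPoint F k, M P ≤ Fintype.card F ^ (k - 2) := by
  intro P
  obtain ⟨R, hR⟩ := hmin
  set N := Fintype.card F ^ (k - 2) with hN
  have hNpos : 0 < N := pow_pos Fintype.card_pos _
  set D : ℤ := (t : ℤ) - s with hD
  have hdvd : D.natAbs ∣ N := by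
    have hgpos : 0 < Nat.gcd D.natAbs N := Nat.gcd_pos_of_pos_right _ hNpos
    have h1 : D.natAbs / Nat.gcd D.natAbs N = 1 := by
      refine hgcd _ fun Q => ?_
      obtain ⟨c, -, hc⟩ := exists_mul_eq_sub_mul h2 hR Q
      have h : D.natAbs ∣ N * M Q :=
        ⟨c.natAbs, by rw [← Int.natAbs_mul, ← hc, Int.natAbs_mul]; simp [hN]⟩
      exact Nat.Coprime.dvd_of_dvd_mul_left (Nat.coprime_div_gcd_div_gcd hgpos)
        (Nat.dvd_of_mul_dvd_mul_left hgpos (by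
          rw [← mul_assoc, Nat.mul_div_cancel' (Nat.gcd_dvd_left _ _),
            Nat.mul_div_cancel' (Nat.gcd_dvd_right _ _)]
          exact h))
    have h3 := Nat.div_mul_cancel (Nat.gcd_dvd_left D.natAbs N)
    rw [h1, one_mul] at h3
    exact h3 ▸ Nat.gcd_dvd_right _ _
  have hDle : |D| ≤ (N : ℤ) := by
    rw [Int.abs_eq_natAbs]
    exact_mod_cast Nat.le_of_dvd hNpos hdvd
  obtain ⟨c, hcle, hc⟩ := exists_mul_eq_sub_mul h2 hR P
  have hle : (N : ℤ) * M P ≤ N * N := by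
    calc (N : ℤ) * M P = D * c := hc
      _ ≤ |D * c| := le_abs_self _
      _ = |D| * |c| := abs_mul _ _
      _ ≤ N * N := mul_le_mul hDle hcle (abs_nonneg _) (Int.natCast_nonneg _)
  exact_mod_cast le_of_mul_le_mul_left hle (by exact_mod_cast hNpos)
end
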